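/- arXiv:0711.0713 — 15 statements merged into one kernel-verified Lean document; each statement's English description precedes it below -/
import Mathlib

section
/- For every real number x > 0, one has ⌊x⌋/(3x + {x}) + {x}/(3x + ⌊x⌋) ≥ 4/15. -/
theorem stmt_0 (x : ℝ) (hx : 0 < x) :
    (⌊x⌋ : ℝ) / (3 * x + Int.fract x) + Int.fract x / (3 * x + (⌊x⌋ : ℝ)) ≥ 4 / 15 := by
  have ha : (0 : ℝ) ≤ (⌊x⌋ : ℝ) := by
    exact_mod_cast Int.floor_nonneg.mpr hx.le
  have hb : 0 ≤ Int.fract x := Int.fract_nonneg x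
  have hab : (⌊x⌋ : ℝ) + Int.fract x = x := Int.floor_add_fract x
  generalize (⌊x⌋ : ℝ) = a at *
  generalize Int.fract x = b at *
  subst hab
  have h1 : 0 < 3 * (a + b) + b := by linarith
  have h2 : 0 < 3 * (a + b) + a := by linarith
  rw [ge_iff_le, div_add_div _ _ h1.ne' h2.ne', div_le_div_iff₀ (by norm_num) (mul_pos h1 h2)]
  nlinarith [sq_nonneg (a - b), sq_nonneg a, sq_nonneg b]
end

section
/- For all real numbers a, b, c, x > 0, one has a/(⌊x⌋·b + {x}·c) + b/(⌊x⌋·c + {x}·a) + c/(⌊x⌋·a + {x}·b) ≥ 3/x. -/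
theorem aux_tangent (a D t : ℝ) (ha : 0 < a) (hD : 0 < D) : 2 * a * t - a * D * t ^ 2 ≤ a / D := by
  rw [le_div_iff₀ hD]
  nlinarith [mul_nonneg ha.le (sq_nonneg (D * t - 1))]

theorem aux_pos (p q u v : ℝ) (hp : 0 ≤ p) (hq : 0 ≤ q) (h : 0 < p + q) (hu : 0 < u)
    (hv : 0 < v) : 0 < p * u + q * v := by
  rcases hp.eq_or_lt with h0 | h0
  · subst h0
    have : 0 < q := by linarith
    positivity
  · positivity

theorem stmt_1 (a b c x : ℝ) (ha : 0 < a) (hb : 0 < b) (hc : 0 < c) (hx : 0 < x) :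
    a / ((⌊x⌋ : ℝ) * b + Int.fract x * c) + b / ((⌊x⌋ : ℝ) * c + Int.fract x * a) +
      c / ((⌊x⌋ : ℝ) * a + Int.fract x * b) ≥ 3 / x := by
  have hp : (0 : ℝ) ≤ (⌊x⌋ : ℝ) := by exact_mod_cast Int.floor_nonneg.mpr hx.le
  have hq : 0 ≤ Int.fract x := Int.fract_nonneg x
  have hpq : (⌊x⌋ : ℝ) + Int.fract x = x := Int.floor_add_fract x
  generalize (⌊x⌋ : ℝ) = p at *
  generalize Int.fract x = q at *
  subst hpq
  set t := (a + b + c) / ((p + q) * (a * b + b * c + c * a)) with ht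
  have h1 := aux_tangent a _ t ha (aux_pos p q b c hp hq hx hb hc)
  have h2 := aux_tangent b _ t hb (aux_pos p q c a hp hq hx hc ha)
  have h3 := aux_tangent c _ t hc (aux_pos p q a b hp hq hx ha hb)
  have hQ : 0 < a * b + b * c + c * a := by positivity
  have h4 : (p + q) * (a * b + b * c + c * a) * t = a + b + c := by
    rw [ht]; field_simp
  have h5 : 3 / (p + q) ≤ (a + b + c) * t := by
    rw [ht, ← mul_div_assoc, div_le_div_iff₀ hx (by positivity)]
    have : 3 * (a * b + b * c + c * a) ≤ (a + b + c) * (a + b + c) := by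
      nlinarith [sq_nonneg (a - b), sq_nonneg (b - c), sq_nonneg (c - a)]
    nlinarith [mul_le_mul_of_nonneg_left this hx.le]
  have h6 : (p + q) * (a * b + b * c + c * a) * t * t = (a + b + c) * t := by rw [h4]
  linarith
end

section
/- For every real number x > 0 and every real number a ≥ 1, one has ⌊x⌋/((a+1)⌊x⌋ + 2{x}) + {x}/((a+1){x} + 2⌊x⌋) ≤ (2a+1)/((a+1)(a+2)). -/
theorem stmt_2 (x a : ℝ) (hx : 0 < x) (ha : 1 ≤ a) :
    (⌊x⌋ : ℝ) / ((a + 1) * (⌊x⌋ : ℝ) + 2 * Int.fract x) +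
      Int.fract x / ((a + 1) * Int.fract x + 2 * (⌊x⌋ : ℝ)) ≤
    (2 * a + 1) / ((a + 1) * (a + 2)) := by
  have hn : (0 : ℝ) ≤ (⌊x⌋ : ℝ) := by exact_mod_cast Int.floor_nonneg.mpr hx.le
  have hf : 0 ≤ Int.fract x := Int.fract_nonneg x
  have hs : 0 < (⌊x⌋ : ℝ) + Int.fract x := by rw [Int.floor_add_fract]; exact hx
  generalize (⌊x⌋ : ℝ) = n at *
  generalize Int.fract x = f at *
  have h1 : 0 < (a + 1) * n + 2 * f := by nlinarith [mul_nonneg (sub_nonneg.2 ha) hn]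
  have h2 : 0 < (a + 1) * f + 2 * n := by nlinarith [mul_nonneg (sub_nonneg.2 ha) hf]
  have h3 : 0 < (a + 1) * (a + 2) := by positivity
  rw [div_add_div _ _ h1.ne' h2.ne', div_le_div_iff₀ (mul_pos h1 h2) h3]
  have hp : 0 ≤ n * f := mul_nonneg hn hf
  have key : 0 ≤ (a - 1) * (2 * (a + 1) * (n - f) ^ 2 + (a + 3) * (n * f)) := by
    have : 0 ≤ a - 1 := sub_nonneg.2 ha
    positivity
  linarith [key]
end

section
/- For every real number x > 0, one has ⌊x⌋³/(⌊x⌋² + ⌊x⌋{x} + {x}²) + {x}³/(3{x}² + 3⌊x⌋{x} + ⌊x⌋²) ≥ x(3⌊x⌋² − {x}²)/(3(3⌊x⌋² + 3⌊x⌋{x} + {x}²)). -/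
theorem stmt_4 (x : ℝ) (hx : 0 < x) :
    (⌊x⌋ : ℝ) ^ 3 / ((⌊x⌋ : ℝ) ^ 2 + (⌊x⌋ : ℝ) * Int.fract x + Int.fract x ^ 2) +
      Int.fract x ^ 3 / (3 * Int.fract x ^ 2 + 3 * (⌊x⌋ : ℝ) * Int.fract x + (⌊x⌋ : ℝ) ^ 2) ≥
    x * (3 * (⌊x⌋ : ℝ) ^ 2 - Int.fract x ^ 2) /
      (3 * (3 * (⌊x⌋ : ℝ) ^ 2 + 3 * (⌊x⌋ : ℝ) * Int.fract x + Int.fract x ^ 2)) := by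
  have key : ∀ a b : ℝ, 0 ≤ a → 0 ≤ b → 0 < a + b →
      a ^ 3 / (a ^ 2 + a * b + b ^ 2) + b ^ 3 / (3 * b ^ 2 + 3 * a * b + a ^ 2) ≥
      (a + b) * (3 * a ^ 2 - b ^ 2) / (3 * (3 * a ^ 2 + 3 * a * b + b ^ 2)) := by
    intro a b ha hb hab
    have hs : 0 < a ^ 2 + a * b + b ^ 2 := by
      nlinarith [mul_pos hab hab, mul_nonneg ha hb, sq_nonneg (a - b)]
    have hm := mul_nonneg ha hb
    have hE : 0 < 3 * b ^ 2 + 3 * a * b + a ^ 2 := by nlinarith [sq_nonneg b]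
    have hF : 0 < 3 * a ^ 2 + 3 * a * b + b ^ 2 := by nlinarith [sq_nonneg a]
    rw [ge_iff_le, div_add_div _ _ hs.ne' hE.ne', div_le_div_iff₀ (by positivity) (by positivity)]
    have hD : 0 ≤ (a ^ 3 * (3 * b ^ 2 + 3 * a * b + a ^ 2) + (a ^ 2 + a * b + b ^ 2) * b ^ 3) *
        (3 * (3 * a ^ 2 + 3 * a * b + b ^ 2)) - (a + b) * (3 * a ^ 2 - b ^ 2) *
        ((a ^ 2 + a * b + b ^ 2) * (3 * b ^ 2 + 3 * a * b + a ^ 2)) := by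
      ring_nf
      positivity
    linarith
  have h := key ⌊x⌋ (Int.fract x) (by exact_mod_cast Int.floor_nonneg.2 hx.le)
    (Int.fract_nonneg x) (by rw [Int.floor_add_fract]; exact hx)
  rwa [Int.floor_add_fract] at h
end

section
/- For every real number x > 1 that is not an integer, one has 4(⌊x⌋³/{x} + {x}³/⌊x⌋) ≥ ⌊x⌋² + ⌊x⌋{x} + {x}². -/
theorem stmt_5 (x : ℝ) (hx : 1 < x) (hni : ¬ ∃ n : ℤ, x = (n : ℝ)) :
    4 * ((⌊x⌋ : ℝ) ^ 3 / Int.fract x + Int.fract x ^ 3 / (⌊x⌋ : ℝ)) ≥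
      (⌊x⌋ : ℝ) ^ 2 + (⌊x⌋ : ℝ) * Int.fract x + Int.fract x ^ 2 := by
  have ha : (1 : ℝ) ≤ (⌊x⌋ : ℝ) := by
    have h : (1 : ℤ) ≤ ⌊x⌋ := Int.le_floor.mpr (by push_cast; exact hx.le)
    exact_mod_cast h
  have hb1 : Int.fract x < 1 := Int.fract_lt_one x
  have hb0 : 0 < Int.fract x := by
    rcases (Int.fract_nonneg x).lt_or_eq with h | h
    · exact h
    · exact absurd ⟨⌊x⌋, by have := Int.floor_add_fract x; linarith⟩ hni
  generalize (⌊x⌋ : ℝ) = a at *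
  generalize Int.fract x = b at *
  have h1 : a ^ 2 ≤ a ^ 3 / b := by
    rw [le_div_iff₀ hb0]
    have : a ^ 2 * b ≤ a ^ 2 * a := mul_le_mul_of_nonneg_left (by linarith) (sq_nonneg a)
    linarith [this, pow_succ a 2]
  have h2 : 0 ≤ b ^ 3 / a := by positivity
  nlinarith
end

section
/- For every real number x > 1 that is not an integer, one has √(⌊x⌋/(x + {x})) + √({x}/(x + ⌊x⌋)) > 1. -/
theorem stmt_7_aux (a b : ℝ) (ha : 0 < a) (hb : 0 < b) :
    a / (a + b) < Real.sqrt (a / (a + b + b)) := by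
  apply Real.lt_sqrt_of_sq_lt
  rw [div_pow, div_lt_div_iff₀ (by positivity) (by positivity)]
  nlinarith [mul_pos ha (mul_pos hb hb)]

theorem stmt_7 (x : ℝ) (hx : 1 < x) (hni : ¬ ∃ n : ℤ, x = (n : ℝ)) :
    Real.sqrt ((⌊x⌋ : ℝ) / (x + Int.fract x)) +
      Real.sqrt (Int.fract x / (x + (⌊x⌋ : ℝ))) > 1 := by
  have h1 : (1 : ℤ) ≤ ⌊x⌋ := Int.le_floor.mpr (by exact_mod_cast hx.le)
  have hn : (0 : ℝ) < (⌊x⌋ : ℝ) := by exact_mod_cast h1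
  have hs : (⌊x⌋ : ℝ) + Int.fract x = x := Int.floor_add_fract x
  have hf : 0 < Int.fract x := by
    rcases (Int.fract_nonneg x).lt_or_eq with h | h
    · exact h
    · exact absurd ⟨⌊x⌋, by linarith⟩ hni
  have A := stmt_7_aux _ _ hn hf
  have B := stmt_7_aux _ _ hf hn
  rw [hs] at A
  rw [add_comm (Int.fract x) (⌊x⌋ : ℝ), hs] at B
  have C : (⌊x⌋ : ℝ) / x + Int.fract x / x = 1 := by
    rw [← add_div, hs, div_self (by linarith)]
  linarith
end

section
/- For every real number x > 0, one has (x² + ⌊x⌋{x})² ≥ 6x²·⌊x⌋·{x}. -/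
theorem stmt_8 (x : ℝ) (hx : 0 < x) :
    (x ^ 2 + (⌊x⌋ : ℝ) * Int.fract x) ^ 2 ≥ 6 * x ^ 2 * (⌊x⌋ : ℝ) * Int.fract x := by
  have h : (⌊x⌋ : ℝ) + Int.fract x = x := Int.floor_add_fract x
  generalize (⌊x⌋ : ℝ) = n at *
  generalize Int.fract x = f at *
  subst h
  have key : ((n + f) ^ 2 + n * f) ^ 2 - 6 * (n + f) ^ 2 * n * f
      = ((n + f) * (n - f)) ^ 2 + (n * f) ^ 2 := by ring
  have h2 : 0 ≤ ((n + f) * (n - f)) ^ 2 + (n * f) ^ 2 := by positivity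
  linarith
end

section
/- For every real number x > 0, one has x² − x·√(⌊x⌋{x}) + ⌊x⌋{x} ≥ (⌊x⌋·√{x} + {x}·√⌊x⌋)·√x. -/
theorem stmt_9 (x : ℝ) (hx : 0 < x) :
    x ^ 2 - x * Real.sqrt ((⌊x⌋ : ℝ) * Int.fract x) + (⌊x⌋ : ℝ) * Int.fract x ≥
      ((⌊x⌋ : ℝ) * Real.sqrt (Int.fract x) + Int.fract x * Real.sqrt (⌊x⌋ : ℝ)) * Real.sqrt x := by
  have hn : (0 : ℝ) ≤ (⌊x⌋ : ℝ) := by exact_mod_cast Int.floor_nonneg.mpr hx.le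
  have hf : 0 ≤ Int.fract x := Int.fract_nonneg x
  have hs : (⌊x⌋ : ℝ) + Int.fract x = x := Int.floor_add_fract x
  rw [Real.sqrt_mul hn]
  generalize (⌊x⌋ : ℝ) = n at *
  generalize Int.fract x = f at *
  have ha := Real.sqrt_nonneg n
  have hb := Real.sqrt_nonneg f
  have hc := Real.sqrt_nonneg x
  have ha2 := Real.sq_sqrt hn
  have hb2 := Real.sq_sqrt hf
  have hc2 := Real.sq_sqrt hx.le
  generalize Real.sqrt n = a at *
  generalize Real.sqrt f = b at *
  generalize Real.sqrt x = c at *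
  have hp : 0 ≤ a * b := mul_nonneg ha hb
  have hx2 : 2 * (a * b) ≤ x := by nlinarith [sq_nonneg (a - b)]
  have h1 : a + b ≤ 3 / 2 * c := by
    refine (sq_le_sq₀ (by positivity) (by positivity)).mp ?_
    nlinarith
  have h2 : (a + b) * c ≤ 3 / 2 * x := by nlinarith
  have h3 : a * b * ((a + b) * c) ≤ a * b * (3 / 2 * x) := mul_le_mul_of_nonneg_left h2 hp
  have h4 : 0 ≤ (x - 2 * (a * b)) * (x - a * b / 2) :=
    mul_nonneg (by linarith) (by linarith)
  have e1 : n * f = (a * b) ^ 2 := by rw [← ha2, ← hb2]; ring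
  have e2 : (n * b + f * a) * c = a * b * ((a + b) * c) := by rw [← ha2, ← hb2]; ring
  rw [e1, e2]
  nlinarith
end

section
/- For every real number x > 0, one has √(⌊x⌋(x + {x})) + √({x}(x + ⌊x⌋)) ≤ (2√2 − 1)·x. -/
theorem stmt_10 (x : ℝ) (hx : 0 < x) :
    Real.sqrt ((⌊x⌋ : ℝ) * (x + Int.fract x)) + Real.sqrt (Int.fract x * (x + (⌊x⌋ : ℝ))) ≤
      (2 * Real.sqrt 2 - 1) * x := by
  have hn : (0 : ℝ) ≤ (⌊x⌋ : ℝ) := by exact_mod_cast Int.floor_nonneg.mpr hx.le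
  have hf : 0 ≤ Int.fract x := Int.fract_nonneg x
  have hs : (⌊x⌋ : ℝ) + Int.fract x = x := Int.floor_add_fract x
  generalize (⌊x⌋ : ℝ) = n at *
  generalize Int.fract x = f at *
  have hA := Real.sq_sqrt (show 0 ≤ n * (x + f) by positivity)
  have hB := Real.sq_sqrt (show 0 ≤ f * (x + n) by positivity)
  have h2 := Real.sq_sqrt (show (0 : ℝ) ≤ 2 by norm_num)
  have h2u : Real.sqrt 2 ≤ 3 / 2 := by
    rw [Real.sqrt_le_left (by norm_num)]; norm_num
  have h2l : 1 ≤ Real.sqrt 2 := by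
    rw [Real.one_le_sqrt]; norm_num
  generalize Real.sqrt (n * (x + f)) = A at *
  generalize Real.sqrt (f * (x + n)) = B at *
  generalize Real.sqrt 2 = s at *
  have h1 : (A + B) ^ 2 ≤ 3 * x ^ 2 := by
    subst hs
    nlinarith [sq_nonneg (A - B), sq_nonneg (n - f)]
  have h3 : 3 * x ^ 2 ≤ ((2 * s - 1) * x) ^ 2 := by
    rw [mul_pow]
    exact mul_le_mul_of_nonneg_right (by nlinarith) (sq_nonneg x)
  exact (le_abs_self _).trans (abs_le_of_sq_le_sq (h1.trans h3) (mul_nonneg (by linarith) hx.le))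
end

section
/- For every real number x > 0, one has (x + ⌊x⌋)³ + (x + {x})³ ≥ 21·x·⌊x⌋·{x} + ⌊x⌋³ + {x}³. -/
theorem stmt_12 (x : ℝ) (hx : 0 < x) :
    (x + (⌊x⌋ : ℝ)) ^ 3 + (x + Int.fract x) ^ 3 ≥
      21 * x * (⌊x⌋ : ℝ) * Int.fract x + (⌊x⌋ : ℝ) ^ 3 + Int.fract x ^ 3 := by
  have h : (⌊x⌋ : ℝ) + Int.fract x = x := Int.floor_add_fract x
  generalize (⌊x⌋ : ℝ) = a at *
  generalize Int.fract x = b at *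
  subst h
  have h2 : 0 ≤ 8 * a ^ 2 - 11 * a * b + 8 * b ^ 2 := by
    nlinarith [sq_nonneg (a - b), sq_nonneg (a + b)]
  have h3 := mul_nonneg hx.le h2
  nlinarith [h3]
end

section
/- For every real number x > 1 that is not an integer, one has √((x + ⌊x⌋)/(x + {x})) + √((x + {x})/(x + ⌊x⌋)) ≤ √(⌊x⌋/{x}) + √({x}/⌊x⌋). -/
theorem stmt_13 (x : ℝ) (hx : 1 < x) (hni : ¬ ∃ n : ℤ, x = (n : ℝ)) :
    Real.sqrt ((x + (⌊x⌋ : ℝ)) / (x + Int.fract x)) +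
      Real.sqrt ((x + Int.fract x) / (x + (⌊x⌋ : ℝ))) ≤
    Real.sqrt ((⌊x⌋ : ℝ) / Int.fract x) + Real.sqrt (Int.fract x / (⌊x⌋ : ℝ)) := by
  have hn : (1 : ℝ) ≤ (⌊x⌋ : ℝ) := by
    have : (1 : ℤ) ≤ ⌊x⌋ := Int.le_floor.mpr (by exact_mod_cast hx.le)
    exact_mod_cast this
  have hsum : (⌊x⌋ : ℝ) + Int.fract x = x := Int.floor_add_fract x
  have hf1 : Int.fract x < 1 := Int.fract_lt_one x
  have hf0 : 0 < Int.fract x := by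
    rcases (Int.fract_nonneg x).lt_or_eq with h | h
    · exact h
    · exact absurd ⟨⌊x⌋, by linarith⟩ hni
  generalize (⌊x⌋ : ℝ) = n at *
  generalize Int.fract x = f at *
  have hA : 0 < x + n := by linarith
  have hB : 0 < x + f := by linarith
  rw [← inv_div (x + n) (x + f), ← inv_div n f, Real.sqrt_inv, Real.sqrt_inv]
  have h1 : 1 ≤ √((x + n) / (x + f)) := by
    rw [Real.one_le_sqrt, one_le_div hB]
    linarith
  have h2 : √((x + n) / (x + f)) ≤ √(n / f) := by
    apply Real.sqrt_le_sqrt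
    rw [div_le_div_iff₀ hB hf0]
    nlinarith
  generalize √((x + n) / (x + f)) = s at *
  generalize √(n / f) = t at *
  have hs : 0 < s := by linarith
  have ht : 0 < t := by linarith
  have key : t + t⁻¹ - (s + s⁻¹) = (t - s) * (s * t - 1) / (s * t) := by
    field_simp
    ring
  have : 0 ≤ (t - s) * (s * t - 1) / (s * t) := by
    apply div_nonneg (mul_nonneg (by linarith) (by nlinarith)) (by positivity)
  linarith
end

section
/- For every real number x, one has |sin ⌊x⌋| + |sin {x}| + |cos x| ≥ 1. -/
theorem stmt_16 (x : ℝ) :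
    |Real.sin (⌊x⌋ : ℝ)| + |Real.sin (Int.fract x)| + |Real.cos x| ≥ 1 := by
  have h1 : |Real.sin x| ≤ |Real.sin (⌊x⌋ : ℝ)| + |Real.sin (Int.fract x)| := by
    have hx : Real.sin x = Real.sin ((⌊x⌋ : ℝ) + Int.fract x) := by
      rw [Int.floor_add_fract]
    rw [hx, Real.sin_add]
    refine (abs_add_le _ _).trans ?_
    rw [abs_mul, abs_mul]
    have a := mul_le_mul_of_nonneg_left (Real.abs_cos_le_one (Int.fract x))
      (abs_nonneg (Real.sin (⌊x⌋ : ℝ)))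
    have b := mul_le_mul_of_nonneg_right (Real.abs_cos_le_one (⌊x⌋ : ℝ))
      (abs_nonneg (Real.sin (Int.fract x)))
    linarith
  have h2 : 1 ≤ |Real.sin x| + |Real.cos x| := by
    have h := Real.sin_sq_add_cos_sq x
    rw [← sq_abs (Real.sin x), ← sq_abs (Real.cos x)] at h
    nlinarith [abs_nonneg (Real.sin x), abs_nonneg (Real.cos x),
      Real.abs_sin_le_one x, Real.abs_cos_le_one x]
  linarith
end

section
/- For every real number x > 0, one has (3⌊x⌋² + 3⌊x⌋{x} + {x}²)·(⌊x⌋² + ⌊x⌋{x} + {x}²)·(3{x}² + 3⌊x⌋{x} + ⌊x⌋²) ≥ (x² + ⌊x⌋{x})³. -/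
theorem stmt_17 (x : ℝ) (hx : 0 < x) :
    (3 * (⌊x⌋ : ℝ) ^ 2 + 3 * (⌊x⌋ : ℝ) * Int.fract x + Int.fract x ^ 2) *
      ((⌊x⌋ : ℝ) ^ 2 + (⌊x⌋ : ℝ) * Int.fract x + Int.fract x ^ 2) *
      (3 * Int.fract x ^ 2 + 3 * (⌊x⌋ : ℝ) * Int.fract x + (⌊x⌋ : ℝ) ^ 2) ≥
    (x ^ 2 + (⌊x⌋ : ℝ) * Int.fract x) ^ 3 := by
  have hb : 0 ≤ Int.fract x := Int.fract_nonneg x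
  have ha : (0 : ℝ) ≤ (⌊x⌋ : ℝ) := by exact_mod_cast Int.floor_nonneg.mpr hx.le
  have hs : x = (⌊x⌋ : ℝ) + Int.fract x := (Int.floor_add_fract x).symm
  generalize (⌊x⌋ : ℝ) = a at *
  generalize Int.fract x = b at *
  subst hs
  have hp : 0 ≤ a * b := mul_nonneg ha hb
  have ht : 0 ≤ (a - b) ^ 2 := sq_nonneg _
  have key : 0 ≤ 22 * (a * b) ^ 3 + 46 * (a * b) ^ 2 * (a - b) ^ 2
      + 18 * (a * b) * ((a - b) ^ 2) ^ 2 + 2 * ((a - b) ^ 2) ^ 3 := by positivity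
  nlinarith [key]
end

section
/- For every real number x > 0, one has ⌊x⌋/((3⌊x⌋ + 2{x})(⌊x⌋ + 2{x})) + {x}/((3{x} + 2⌊x⌋)({x} + 2⌊x⌋)) ≥ 11/(48x). -/
theorem aux_18 (a b : ℝ) (ha : 0 ≤ a) (hb : 0 ≤ b) (h : 0 < a + b) :
    a / (4 * (a + b) ^ 2) ≤ a / ((3 * a + 2 * b) * (a + 2 * b)) := by
  rcases ha.eq_or_lt with h0 | h0
  · simp [← h0]
  · apply div_le_div_of_nonneg_left ha (by positivity)
    nlinarith [sq_nonneg a]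

theorem stmt_18 (x : ℝ) (hx : 0 < x) :
    (⌊x⌋ : ℝ) / ((3 * (⌊x⌋ : ℝ) + 2 * Int.fract x) * ((⌊x⌋ : ℝ) + 2 * Int.fract x)) +
      Int.fract x / ((3 * Int.fract x + 2 * (⌊x⌋ : ℝ)) * (Int.fract x + 2 * (⌊x⌋ : ℝ))) ≥
    11 / (48 * x) := by
  have hb : 0 ≤ Int.fract x := Int.fract_nonneg x
  have ha : (0 : ℝ) ≤ (⌊x⌋ : ℝ) := by exact_mod_cast Int.floor_nonneg.mpr hx.le
  have hab : (⌊x⌋ : ℝ) + Int.fract x = x := Int.floor_add_fract x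
  generalize (⌊x⌋ : ℝ) = a at *
  generalize Int.fract x = b at *
  subst hab
  have h1 := aux_18 a b ha hb hx
  have h2 := aux_18 b a hb ha (by linarith)
  rw [add_comm b a] at h2
  have h3 : a / (4 * (a + b) ^ 2) + b / (4 * (a + b) ^ 2) = 12 / (48 * (a + b)) := by
    field_simp
    norm_num
  have h4 : 11 / (48 * (a + b)) ≤ 12 / (48 * (a + b)) := by
    gcongr
    norm_num
  linarith
end

section
/- For every real number x > 0, one has 1/(x + ⌊x⌋)² + 1/(x + {x})² ≥ (5x² − 4⌊x⌋{x})/(4x²(x² + ⌊x⌋{x})). -/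
theorem stmt_19_aux (a b : ℝ) (ha : 0 ≤ a) (hb : 0 ≤ b) (hx : 0 < a + b) :
    1 / (a + b + a) ^ 2 + 1 / (a + b + b) ^ 2 ≥
      (5 * (a + b) ^ 2 - 4 * a * b) / (4 * (a + b) ^ 2 * ((a + b) ^ 2 + a * b)) := by
  have hp : 0 ≤ a * b := mul_nonneg ha hb
  have h1 : 0 < a + b + a := by linarith
  have h2 : 0 < a + b + b := by linarith
  have hs : 0 < (a + b) ^ 2 := by positivity
  have hq : 0 < (a + b) ^ 2 + a * b := by linarith
  have key : 1 / (a + b + a) ^ 2 + 1 / (a + b + b) ^ 2 -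
      (5 * (a + b) ^ 2 - 4 * a * b) / (4 * (a + b) ^ 2 * ((a + b) ^ 2 + a * b)) =
      (a * b * (8 * ((a + b) ^ 2) ^ 2 + 3 * (a * b) * (a + b) ^ 2 + 4 * (a * b) ^ 2)) /
      (4 * (a + b) ^ 2 * ((a + b) ^ 2 + a * b) * ((a + b + a) ^ 2 * (a + b + b) ^ 2)) := by
    have e1 := h1.ne'
    have e2 := h2.ne'
    have e3 := hx.ne'
    have e4 := hq.ne'
    rw [div_add_div _ _ (pow_ne_zero 2 e1) (pow_ne_zero 2 e2),
      div_sub_div _ _ (by positivity) (by positivity), div_eq_div_iff (by positivity) (by positivity)]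
    ring
  have : 0 ≤ (a * b * (8 * ((a + b) ^ 2) ^ 2 + 3 * (a * b) * (a + b) ^ 2 + 4 * (a * b) ^ 2)) /
      (4 * (a + b) ^ 2 * ((a + b) ^ 2 + a * b) * ((a + b + a) ^ 2 * (a + b + b) ^ 2)) := by
    positivity
  linarith

theorem stmt_19 (x : ℝ) (hx : 0 < x) :
    1 / (x + (⌊x⌋ : ℝ)) ^ 2 + 1 / (x + Int.fract x) ^ 2 ≥
      (5 * x ^ 2 - 4 * (⌊x⌋ : ℝ) * Int.fract x) /
        (4 * x ^ 2 * (x ^ 2 + (⌊x⌋ : ℝ) * Int.fract x)) := by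
  have h := stmt_19_aux (⌊x⌋ : ℝ) (Int.fract x)
    (by exact_mod_cast Int.floor_nonneg.mpr hx.le) (Int.fract_nonneg x)
    (by rw [Int.floor_add_fract]; exact hx)
  rw [Int.floor_add_fract] at h
  exact h
end
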